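/- arXiv:1910.00581 — 6 statements merged into one kernel-verified Lean document; each statement's English description precedes it below -/
import Mathlib

section
/- Let G be a finite simple graph containing no K_{3,3} as a subgraph (i.e., there do not exist six pairwise distinct vertices a1,a2,a3,b1,b2,b3 such that a_i is adjacent to b_j for all i,j). Let u and v be distinct vertices of G and let s be any vertex with s ≠ u and s ≠ v. Then the closed neighborhood N[s] of s contains at most 3 vertices of N(u) ∩ N(v). -/
/-- `G` contains no `K_{3,3}` as a subgraph: there do not exist six pairwise
distinct vertices `a 0, a 1, a 2, b 0, b 1, b 2` with `a i` adjacent to `b j`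
for all `i, j`. -/
def K33SubgraphFree {V : Type*} (G : SimpleGraph V) : Prop :=
  ¬ ∃ a b : Fin 3 → V,
      Function.Injective (Sum.elim a b : Fin 3 ⊕ Fin 3 → V) ∧
      ∀ i j : Fin 3, G.Adj (a i) (b j)

/-- In a `K_{3,3}`-subgraph-free graph, three distinct vertices have at most two common
neighbors. -/
theorem K33SubgraphFree.card_common_nbrs_le_two
    {V : Type*} [Fintype V] [DecidableEq V]
    {G : SimpleGraph V} [DecidableRel G.Adj]
    (hK : K33SubgraphFree G)
    {u v s : V} (huv : u ≠ v) (hsu : s ≠ u) (hsv : s ≠ v) :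
    (G.neighborFinset s ∩ (G.neighborFinset u ∩ G.neighborFinset v)).card ≤ 2 := by
  by_contra! h
  obtain ⟨x, hx, y, hy, z, hz, hxy, hxz, hyz⟩ := Finset.two_lt_card.mp h
  simp only [Finset.mem_inter, SimpleGraph.mem_neighborFinset] at hx hy hz
  have hadj : ∀ i j : Fin 3, G.Adj (![s, u, v] i) (![x, y, z] j) := by
    simp [Fin.forall_fin_succ, hx, hy, hz]
  refine hK ⟨![s, u, v], ![x, y, z], ?_, hadj⟩
  refine Function.Injective.sumElim ?_ ?_ fun i j => (hadj i j).ne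
  · simp [Function.Injective, Fin.forall_fin_succ, huv, hsu, hsv, huv.symm, hsu.symm, hsv.symm]
  · simp [Function.Injective, Fin.forall_fin_succ, hxy, hxz, hyz, hxy.symm, hxz.symm, hyz.symm]

/-- If `G` is `K_{3,3}`-subgraph-free, `u ≠ v` and `s` is a vertex different from both
`u` and `v`, then the closed neighborhood of `s` contains at most `3` vertices of
`N(u) ∩ N(v)`. -/
theorem closedNbhd_inter_common_nbrs_card_le_three
    {V : Type*} [Fintype V] [DecidableEq V]
    (G : SimpleGraph V) [DecidableRel G.Adj]
    (hK : K33SubgraphFree G)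
    (u v s : V) (huv : u ≠ v) (hsu : s ≠ u) (hsv : s ≠ v) :
    ((insert s (G.neighborFinset s)) ∩
      (G.neighborFinset u ∩ G.neighborFinset v)).card ≤ 3 := by
  calc
    _ ≤ (insert s (G.neighborFinset s ∩
          (G.neighborFinset u ∩ G.neighborFinset v))).card := by
      refine Finset.card_le_card fun x hx => ?_
      simp only [Finset.mem_inter, Finset.mem_insert] at hx ⊢
      tauto
    _ ≤ (G.neighborFinset s ∩ (G.neighborFinset u ∩ G.neighborFinset v)).card + 1 :=
      Finset.card_insert_le _ _
    _ ≤ 3 := Nat.succ_le_succ (hK.card_common_nbrs_le_two huv hsu hsv)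
end

section
/- Let G be a finite simple graph containing no K_{3,3} as a subgraph, let k be a natural number, and let u, v be distinct vertices of G with |N(u) ∩ N(v)| > 3k. Then every dominating set D of G with |D| ≤ k contains u or contains v. -/
/-- `D` is a dominating set of `G`: every vertex lies in `D` or is adjacent to a
vertex of `D`. -/
def Dominates {V : Type*} (G : SimpleGraph V) (D : Finset V) : Prop :=
  ∀ w : V, w ∈ D ∨ ∃ x ∈ D, G.Adj x w

/-- In a `K_{3,3}`-subgraph-free graph, three distinct vertices have at most two common
neighbors. -/
lemma K33SubgraphFree.card_common_neighbors_le_two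
    {V : Type*} [Fintype V] [DecidableEq V]
    {G : SimpleGraph V} [DecidableRel G.Adj] (hK : K33SubgraphFree G) {u v x : V}
    (huv : u ≠ v) (hxu : x ≠ u) (hxv : x ≠ v) :
    (G.neighborFinset x ∩ (G.neighborFinset u ∩ G.neighborFinset v)).card ≤ 2 := by
  by_contra! h
  obtain ⟨p, hp, q, hq, r, hr, hpq, hpr, hqr⟩ := Finset.two_lt_card.1 h
  simp only [Finset.mem_inter, SimpleGraph.mem_neighborFinset] at hp hq hr
  have hadj : ∀ i j : Fin 3, G.Adj (![x, u, v] i) (![p, q, r] j) := by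
    simp [Fin.forall_fin_succ, hp, hq, hr]
  refine hK ⟨![x, u, v], ![p, q, r], ?_, hadj⟩
  refine Function.Injective.sumElim ?_ ?_ fun i j => (hadj i j).ne
  · simp [Function.Injective, Fin.forall_fin_succ, huv, huv.symm, hxu, hxu.symm, hxv, hxv.symm]
  · simp [Function.Injective, Fin.forall_fin_succ, hpq, hpq.symm, hpr, hpr.symm, hqr, hqr.symm]

/-- If `G` is `K_{3,3}`-subgraph-free and `u ≠ v` with `|N(u) ∩ N(v)| > 3k`, then
every dominating set of `G` of size at most `k` contains `u` or `v`. -/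
theorem mem_dominatingSet_of_thick_diamond
    {V : Type*} [Fintype V] [DecidableEq V]
    (G : SimpleGraph V) [DecidableRel G.Adj]
    (hK : K33SubgraphFree G) (k : ℕ) (u v : V) (huv : u ≠ v)
    (hthick : 3 * k < (G.neighborFinset u ∩ G.neighborFinset v).card)
    (D : Finset V) (hD : Dominates G D) (hcard : D.card ≤ k) :
    u ∈ D ∨ v ∈ D := by
  by_contra! hmem
  obtain ⟨hu, hv⟩ := hmem
  set C := G.neighborFinset u ∩ G.neighborFinset v
  have hsub : C ⊆ D.biUnion fun x => insert x (G.neighborFinset x ∩ C) := by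
    intro w hw
    rw [Finset.mem_biUnion]
    rcases hD w with h | ⟨x, hx, hxw⟩
    · exact ⟨w, h, Finset.mem_insert_self _ _⟩
    · exact ⟨x, hx, Finset.mem_insert_of_mem <|
        Finset.mem_inter.2 ⟨(G.mem_neighborFinset x w).2 hxw, hw⟩⟩
  have hcover : (D.biUnion fun x => insert x (G.neighborFinset x ∩ C)).card ≤ D.card * 3 :=
    Finset.card_biUnion_le_card_mul _ _ _ fun x hx =>
      (Finset.card_insert_le _ _).trans <| Nat.succ_le_succ <|
        hK.card_common_neighbors_le_two huv (ne_of_mem_of_not_mem hx hu)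
          (ne_of_mem_of_not_mem hx hv)
  have := Finset.card_le_card hsub
  lia
end

section
/- Let G be a finite simple graph and let t, k be natural numbers such that every pair of distinct vertices x, y of G satisfies |N(x) ∩ N(y)| ≤ t (i.e., every diamond of G has thickness at most t). If a vertex v has degree greater than (t+1)·k, then every dominating set of G of size at most k contains v. -/
/-- If every diamond of `G` has thickness at most `t` (i.e. `|N(x) ∩ N(y)| ≤ t` for
all distinct `x, y`), and `v` has degree greater than `(t+1)·k`, then every
dominating set of `G` of size at most `k` contains `v`. -/
theorem highDegree_mem_dominatingSet
    {V : Type*} [Fintype V] [DecidableEq V]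
    (G : SimpleGraph V) [DecidableRel G.Adj] (t k : ℕ)
    (hthin : ∀ x y : V, x ≠ y →
      (G.neighborFinset x ∩ G.neighborFinset y).card ≤ t)
    (v : V) (hdeg : (t + 1) * k < G.degree v)
    (D : Finset V) (hD : Dominates G D) (hcard : D.card ≤ k) :
    v ∈ D := by
  by_contra hv
  have hsub : G.neighborFinset v ⊆
      D.biUnion fun x => insert x (G.neighborFinset x ∩ G.neighborFinset v) := by
    intro w hw
    rw [Finset.mem_biUnion]
    rcases hD w with hwD | ⟨x, hxD, hxw⟩
    · exact ⟨w, hwD, Finset.mem_insert_self _ _⟩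
    · exact ⟨x, hxD, Finset.mem_insert_of_mem
        (Finset.mem_inter.2 ⟨(G.mem_neighborFinset x w).2 hxw, hw⟩)⟩
  have hbound : G.degree v ≤ D.card * (t + 1) :=
    (Finset.card_le_card hsub).trans <| Finset.card_biUnion_le_card_mul _ _ _ fun x hx =>
      (Finset.card_insert_le _ _).trans <|
        Nat.succ_le_succ (hthin x v (ne_of_mem_of_not_mem hx hv))
  have hle : D.card * (t + 1) ≤ k * (t + 1) := Nat.mul_le_mul_right _ hcard
  rw [mul_comm] at hdeg
  exact absurd hdeg (hbound.trans hle).not_gt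
end

section
/- Let G be a finite simple graph and k a natural number. Define the graph H as follows: the vertex set of H is the disjoint union of a root vertex r, a set A = {a_u : u ∈ V(G)} of copies of the vertices of G, a set B = {b_u : u ∈ V(G)} of copies of the vertices of G, and a set P of k+1 additional vertices; the edges of H are: r is adjacent to every vertex of A and to every vertex of P, and a_u is adjacent to b_v if and only if u = v or u is adjacent to v in G; there are no other edges. Then G has a dominating set of size at most k if and only if H has a connected dominating set of size at most k + 1. -/
/-- `D` is a connected dominating set of `G`. -/
def IsCDS {V : Type*} (G : SimpleGraph V) (D : Finset V) : Prop :=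
  (∀ w : V, w ∈ D ∨ ∃ x ∈ D, G.Adj x w) ∧ (G.induce (↑D : Set V)).Connected

/-- The base relation of the graph `H` of the standard reduction: the vertex set
consists of a root `r` (the `Unit` summand), a copy `A` of `V(G)` (first `V`
summand, vertices `a_u`), a copy `B` of `V(G)` (second `V` summand, vertices
`b_u`), and a set `P` of `k + 1` extra vertices (the `Fin (k+1)` summand).
The root is related to every vertex of `A` and of `P`, and `a_u` is related to
`b_v` iff `u = v` or `u` is adjacent to `v` in `G`. -/
def redRel {V : Type*} (G : SimpleGraph V) (k : ℕ) :
    (Unit ⊕ V ⊕ V ⊕ Fin (k + 1)) → (Unit ⊕ V ⊕ V ⊕ Fin (k + 1)) → Prop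
  | Sum.inl _, Sum.inr (Sum.inl _) => True
  | Sum.inl _, Sum.inr (Sum.inr (Sum.inr _)) => True
  | Sum.inr (Sum.inl u), Sum.inr (Sum.inr (Sum.inl v)) => u = v ∨ G.Adj u v
  | _, _ => False

/-- The reduction graph `H`: its edges are exactly the (symmetrized) pairs related
by `redRel`. -/
def redGraph {V : Type*} (G : SimpleGraph V) (k : ℕ) :
    SimpleGraph (Unit ⊕ V ⊕ V ⊕ Fin (k + 1)) :=
  SimpleGraph.fromRel (redRel G k)

/-- The vertices of `G` of which a vertex of the reduction graph is a copy: one for `a_u` and `b_u`,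
none for the root and the extra vertices. -/
def redVertexOrigin {V : Type*} {k : ℕ} : (Unit ⊕ V ⊕ V ⊕ Fin (k + 1)) → Finset V
  | Sum.inr (Sum.inl u) => {u}
  | Sum.inr (Sum.inr (Sum.inl u)) => {u}
  | _ => ∅

lemma card_redVertexOrigin_le_one {V : Type*} {k : ℕ} (x : Unit ⊕ V ⊕ V ⊕ Fin (k + 1)) :
    (redVertexOrigin x).card ≤ 1 := by
  rcases x with _ | _ | _ | _ <;> simp [redVertexOrigin]

/-- A dominating set of `G`, lifted to the `a_u` and joined by the root, is a connected dominating
set of the reduction graph. -/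
lemma Dominates.isCDS_redGraph {V : Type*} [DecidableEq V] {G : SimpleGraph V} {D : Finset V}
    (hD : Dominates G D) (k : ℕ) :
    IsCDS (redGraph G k)
      (insert (Sum.inl ()) (D.image fun u => Sum.inr (Sum.inl u))) := by
  refine ⟨?_, ?_⟩
  · rintro (_ | u | u | p)
    · simp
    · exact Or.inr ⟨Sum.inl (), by simp, by simp [redGraph, redRel]⟩
    · rcases hD u with hu | ⟨v, hv, hvu⟩
      · exact Or.inr ⟨Sum.inr (Sum.inl u), by simp [hu], by simp [redGraph, redRel]⟩
      · exact Or.inr ⟨Sum.inr (Sum.inl v), by simp [hv], by simp [redGraph, redRel, hvu]⟩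
    · exact Or.inr ⟨Sum.inl (), by simp, by simp [redGraph, redRel]⟩
  · rw [SimpleGraph.connected_iff_exists_forall_reachable]
    refine ⟨⟨Sum.inl (), by simp⟩, ?_⟩
    rintro ⟨_ | u | u | p, hx⟩
    · exact .refl _
    · exact SimpleGraph.Adj.reachable (by simp [redGraph, redRel])
    · simp at hx
    · simp at hx

/-- A dominating set of the reduction graph contains the root or an extra vertex. -/
lemma Dominates.exists_mem_redVertexOrigin_eq_empty {V : Type*} {G : SimpleGraph V} {k : ℕ}
    {D : Finset (Unit ⊕ V ⊕ V ⊕ Fin (k + 1))} (hD : Dominates (redGraph G k) D) :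
    ∃ x ∈ D, redVertexOrigin x = ∅ := by
  rcases hD (Sum.inr (Sum.inr (Sum.inr 0))) with h | ⟨x, hx, hadj⟩
  · exact ⟨_, h, rfl⟩
  · refine ⟨x, hx, ?_⟩
    rcases x with _ | _ | _ | _ <;> simp_all [redGraph, redRel, redVertexOrigin]

/-- A dominating set of the reduction graph projects to a dominating set of `G`. -/
lemma Dominates.biUnion_redVertexOrigin {V : Type*} [DecidableEq V] {G : SimpleGraph V} {k : ℕ}
    {D : Finset (Unit ⊕ V ⊕ V ⊕ Fin (k + 1))} (hD : Dominates (redGraph G k) D) :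
    Dominates G (D.biUnion redVertexOrigin) := by
  intro v
  rcases hD (Sum.inr (Sum.inr (Sum.inl v))) with h | ⟨x, hx, hadj⟩
  · exact Or.inl (Finset.mem_biUnion.2 ⟨_, h, by simp [redVertexOrigin]⟩)
  · rcases x with _ | u | _ | _
    · simp [redGraph, redRel] at hadj
    · have hu : u ∈ D.biUnion redVertexOrigin :=
        Finset.mem_biUnion.2 ⟨_, hx, by simp [redVertexOrigin]⟩
      have huv : u = v ∨ G.Adj u v := by simpa [redGraph, redRel] using hadj
      rcases huv with rfl | huv
      · exact Or.inl hu
      · exact Or.inr ⟨u, hu, huv⟩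
    · simp [redGraph, redRel] at hadj
    · simp [redGraph, redRel] at hadj

/-- `G` has a dominating set of size at most `k` iff the reduction graph `H` has a
connected dominating set of size at most `k + 1`. -/
theorem dominatingSet_iff_connectedDominatingSet_redGraph
    {V : Type*} [Fintype V] [DecidableEq V] (G : SimpleGraph V) (k : ℕ) :
    (∃ D : Finset V, Dominates G D ∧ D.card ≤ k) ↔
      (∃ D' : Finset (Unit ⊕ V ⊕ V ⊕ Fin (k + 1)),
        IsCDS (redGraph G k) D' ∧ D'.card ≤ k + 1) := by
  constructor
  · rintro ⟨D, hD, hcard⟩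
    refine ⟨_, hD.isCDS_redGraph k, (Finset.card_insert_le _ _).trans ?_⟩
    exact Nat.succ_le_succ (Finset.card_image_le.trans hcard)
  · rintro ⟨D, ⟨hD, -⟩, hcard⟩
    replace hD : Dominates (redGraph G k) D := hD
    obtain ⟨x, hx, hempty⟩ := hD.exists_mem_redVertexOrigin_eq_empty
    refine ⟨_, hD.biUnion_redVertexOrigin, ?_⟩
    rw [← Finset.insert_erase hx, Finset.biUnion_insert, hempty, Finset.empty_union]
    refine (Finset.card_biUnion_le_card_mul _ _ 1 fun y _ =>
      card_redVertexOrigin_le_one y).trans ?_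
    rw [Finset.card_erase_of_mem hx]
    omega
end

section
/- Let d, k, k' be natural numbers with k' ≥ 1, let G be a d-degenerate finite simple graph, and let c : V(G) → {1, …, k'} be any function. Define the graph H as follows: the vertex set of H is the disjoint union of V(G), a set {d_1, …, d_{k'}} of new hub vertices, and a set {x_{i,j} : 1 ≤ i ≤ k', 1 ≤ j ≤ 2k+1} of new pendant vertices; the edges of H are: all edges of G, an edge between d_i and every vertex v ∈ V(G) with c(v) = i, and an edge between d_i and x_{i,j} for every i and j; there are no other edges. Then H is (d+1)-degenerate. -/
/-- `G` is `d`-degenerate: every nonempty set of vertices contains a vertex having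
at most `d` neighbors inside the set. -/
def IsDegenerate {V : Type*} [Fintype V] (G : SimpleGraph V) (d : ℕ) : Prop :=
  ∀ S : Set V, S.Nonempty → ∃ v ∈ S, (G.neighborSet v ∩ S).ncard ≤ d

/-- The base relation of the graph `H` obtained from `G`, hub vertices
`d_i` (`i : Fin k'`, first summand on the right) and pendant vertices
`x_{i,j}` (`(i, j) : Fin k' × Fin (2k+1)`, second summand on the right):
`H` keeps all edges of `G`, joins `d_i` to every `v` with `c v = i`, and joins
`d_i` to every `x_{i,j}`. -/
def hubRel {V : Type*} (G : SimpleGraph V) (k k' : ℕ) (c : V → Fin k') :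
    (V ⊕ Fin k' ⊕ Fin k' × Fin (2 * k + 1)) →
    (V ⊕ Fin k' ⊕ Fin k' × Fin (2 * k + 1)) → Prop
  | Sum.inl u, Sum.inl v => G.Adj u v
  | Sum.inl v, Sum.inr (Sum.inl i) => c v = i
  | Sum.inr (Sum.inl i), Sum.inr (Sum.inr p) => p.1 = i
  | _, _ => False

/-- The graph `H` of the reduction from CCS-R to CDS-R. -/
def hubGraph {V : Type*} (G : SimpleGraph V) (k k' : ℕ) (c : V → Fin k') :
    SimpleGraph (V ⊕ Fin k' ⊕ Fin k' × Fin (2 * k + 1)) :=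
  SimpleGraph.fromRel (hubRel G k k' c)

/-- If `G` is `d`-degenerate then the graph `H` of the reduction is
`(d+1)`-degenerate. -/
theorem hubGraph_degenerate
    {V : Type*} [Fintype V] (G : SimpleGraph V)
    (d k k' : ℕ) (hk' : 1 ≤ k') (c : V → Fin k')
    (hG : IsDegenerate G d) :
    IsDegenerate (hubGraph G k k' c) (d + 1) := by
  intro S hS
  by_cases hV : (Sum.inl ⁻¹' S).Nonempty
  · obtain ⟨v, hvS, hv⟩ := hG _ hV
    refine ⟨Sum.inl v, hvS, ?_⟩
    have hsub : (hubGraph G k k' c).neighborSet (Sum.inl v) ∩ S ⊆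
        insert (Sum.inr (Sum.inl (c v)))
          (Sum.inl '' (G.neighborSet v ∩ Sum.inl ⁻¹' S)) := by
      rintro (u | i | p) ⟨hadj, hmem⟩ <;>
        simp_all [hubGraph, hubRel, G.adj_comm]
    calc _ ≤ _ := Set.ncard_le_ncard hsub (Set.toFinite _)
      _ ≤ _ := Set.ncard_insert_le _ _
      _ ≤ d + 1 := by rwa [Set.ncard_image_of_injective _ Sum.inl_injective, add_le_add_iff_right]
  have hV' : ∀ v : V, Sum.inl v ∉ S := fun v hv => hV ⟨v, hv⟩
  by_cases hP : ∃ p, Sum.inr (Sum.inr p) ∈ S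
  · obtain ⟨p, hp⟩ := hP
    refine ⟨_, hp, ?_⟩
    have hsub : (hubGraph G k k' c).neighborSet (Sum.inr (Sum.inr p)) ∩ S ⊆
        {Sum.inr (Sum.inl p.1)} := by
      rintro (u | i | q) ⟨hadj, hmem⟩ <;> simp_all [hubGraph, hubRel]
    calc _ ≤ _ := Set.ncard_le_ncard hsub (Set.toFinite _)
      _ = 1 := Set.ncard_singleton _
      _ ≤ d + 1 := Nat.le_add_left 1 d
  · obtain ⟨w, hw⟩ := hS
    refine ⟨w, hw, ?_⟩
    have hempty : (hubGraph G k k' c).neighborSet w ∩ S = ∅ := by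
      refine Set.eq_empty_of_forall_notMem ?_
      rcases w with v | i | p
      · exact absurd hw (hV' v)
      · rintro (u | j | q) ⟨hadj, hmem⟩
        · exact hV' u hmem
        · simp [hubGraph, hubRel] at hadj
        · exact hP ⟨q, hmem⟩
      · exact absurd ⟨p, hw⟩ hP
    simp [hempty]
end

section
/- Let G be a finite simple graph, k ≥ 1, k' ≥ 1, and let c : V(G) → {1, …, k'} be a vertex coloring. Define the graph H as follows: the vertex set of H is the disjoint union of V(G), new hub vertices D = {d_1, …, d_{k'}}, and new pendant vertices {x_{i,j} : 1 ≤ i ≤ k', 1 ≤ j ≤ 2k+1}; the edges of H are: all edges of G, an edge between d_i and every vertex v ∈ V(G) with c(v) = i, and an edge between d_i and x_{i,j} for every i and j; there are no other edges. If S_1, …, S_t is a sequence of subsets of V(G) such that for every i: |S_i| ≤ k, the subgraph of G induced by S_i is connected, S_i contains at least one vertex of every color class of c, and |S_i Δ S_{i+1}| = 1 for every i < t, then S_1 ∪ D, …, S_t ∪ D is a TAR reconfiguration sequence of connected dominating sets of H with threshold k + k' (i.e., each S_i ∪ D is a connected dominating set of H of size at most k + k', and consecutive sets differ in exactly one vertex).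 -/
/-- The set of hub vertices `D = {d_1, …, d_{k'}}` of `H`. -/
def hubSet (V : Type*) [DecidableEq V] (k k' : ℕ) :
    Finset (V ⊕ Fin k' ⊕ Fin k' × Fin (2 * k + 1)) :=
  Finset.univ.image (fun i : Fin k' => Sum.inr (Sum.inl i))

/-- The image `X ∪ D` in `H` of a set `X` of vertices of `G`. -/
def liftSet {V : Type*} [DecidableEq V] (k k' : ℕ) (X : Finset V) :
    Finset (V ⊕ Fin k' ⊕ Fin k' × Fin (2 * k + 1)) :=
  X.image Sum.inl ∪ hubSet V k k'

section LiftSet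

variable {V : Type*} [DecidableEq V] {k k' : ℕ}

@[simp]
theorem inl_mem_liftSet {X : Finset V} {v : V} : Sum.inl v ∈ liftSet k k' X ↔ v ∈ X := by
  simp [liftSet, hubSet]

@[simp]
theorem hub_mem_liftSet {X : Finset V} {i : Fin k'} :
    Sum.inr (Sum.inl i) ∈ liftSet k k' X := by
  simp [liftSet, hubSet]

@[simp]
theorem pendant_notMem_liftSet {X : Finset V} {p : Fin k' × Fin (2 * k + 1)} :
    Sum.inr (Sum.inr p) ∉ liftSet k k' X := by
  simp [liftSet, hubSet]

theorem card_liftSet_le (X : Finset V) : (liftSet k k' X).card ≤ X.card + k' := by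
  refine (Finset.card_union_le _ _).trans (Nat.add_le_add Finset.card_image_le ?_)
  exact Finset.card_image_le.trans (by simp)

theorem liftSet_sdiff_liftSet (X Y : Finset V) :
    liftSet k k' X \ liftSet k k' Y = (X \ Y).image Sum.inl := by
  ext (v | i | p) <;> simp

theorem card_symmDiff_liftSet (X Y : Finset V) :
    ((liftSet k k' X \ liftSet k k' Y) ∪ (liftSet k k' Y \ liftSet k k' X)).card =
      ((X \ Y) ∪ (Y \ X)).card := by
  rw [liftSet_sdiff_liftSet, liftSet_sdiff_liftSet, ← Finset.image_union,
    Finset.card_image_of_injective _ Sum.inl_injective]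

end LiftSet

section HubGraph

variable {V : Type*} {G : SimpleGraph V} {k k' : ℕ} {c : V → Fin k'}

theorem hubGraph_adj_inl_inl {u v : V} (h : G.Adj u v) :
    (hubGraph G k k' c).Adj (Sum.inl u) (Sum.inl v) :=
  (SimpleGraph.fromRel_adj _ _ _).2 ⟨by simpa using h.ne, Or.inl h⟩

theorem hubGraph_adj_inl_hub (v : V) :
    (hubGraph G k k' c).Adj (Sum.inl v) (Sum.inr (Sum.inl (c v))) :=
  (SimpleGraph.fromRel_adj _ _ _).2 ⟨by simp, Or.inl rfl⟩

theorem hubGraph_adj_hub_pendant (p : Fin k' × Fin (2 * k + 1)) :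
    (hubGraph G k k' c).Adj (Sum.inr (Sum.inl p.1)) (Sum.inr (Sum.inr p)) :=
  (SimpleGraph.fromRel_adj _ _ _).2 ⟨by simp, Or.inl rfl⟩

variable [DecidableEq V]

theorem liftSet_dominates (X : Finset V) (w : V ⊕ Fin k' ⊕ Fin k' × Fin (2 * k + 1)) :
    w ∈ liftSet k k' X ∨ ∃ x ∈ liftSet k k' X, (hubGraph G k k' c).Adj x w := by
  obtain v | i | p := w
  · exact Or.inr ⟨_, hub_mem_liftSet, (hubGraph_adj_inl_hub v).symm⟩
  · exact Or.inl hub_mem_liftSet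
  · exact Or.inr ⟨_, hub_mem_liftSet, hubGraph_adj_hub_pendant p⟩

theorem connected_induce_liftSet {X : Finset V}
    (hconn : (G.induce (↑X : Set V)).Connected) (hcolor : ∀ j, ∃ v ∈ X, c v = j) :
    ((hubGraph G k k' c).induce (↑(liftSet k k' X) : Set _)).Connected := by
  let f : G.induce (↑X : Set V) →g
      (hubGraph G k k' c).induce (↑(liftSet k k' X) : Set _) :=
    { toFun := fun v => ⟨Sum.inl v.1, inl_mem_liftSet.2 v.2⟩
      map_rel' := fun h => hubGraph_adj_inl_inl h }
  obtain ⟨r⟩ := hconn.nonempty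
  refine SimpleGraph.connected_iff_exists_forall_reachable _ |>.2 ⟨f r, ?_⟩
  rintro ⟨v | i | p, hw⟩
  · exact (hconn.preconnected r ⟨v, inl_mem_liftSet.1 hw⟩).map f
  · obtain ⟨v, hv, rfl⟩ := hcolor i
    refine ((hconn.preconnected r ⟨v, hv⟩).map f).trans (SimpleGraph.Adj.reachable ?_)
    exact hubGraph_adj_inl_hub v
  · exact absurd hw pendant_notMem_liftSet

end HubGraph

/-- If `S_1, …, S_t` are subsets of `V(G)`, each of size at most `k`, inducing a
connected subgraph of `G`, containing a vertex of every color class of `c`, with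
consecutive sets differing in exactly one vertex, then `S_1 ∪ D, …, S_t ∪ D` is a
TAR reconfiguration sequence of connected dominating sets of `H` with threshold
`k + k'`: each `S_i ∪ D` is a connected dominating set of `H` of size at most
`k + k'`, and consecutive sets differ in exactly one vertex. -/
theorem liftSeq_is_TAR_sequence
    {V : Type*} [Fintype V] [DecidableEq V] (G : SimpleGraph V)
    (k k' : ℕ) (hk : 1 ≤ k) (hk' : 1 ≤ k') (c : V → Fin k')
    (t : ℕ) (S : Fin (t + 1) → Finset V)
    (hcard : ∀ i, (S i).card ≤ k)
    (hconn : ∀ i, (G.induce (↑(S i) : Set V)).Connected)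
    (hcolor : ∀ i, ∀ j : Fin k', ∃ v ∈ S i, c v = j)
    (hstep : ∀ i : Fin t,
      ((S i.castSucc \ S i.succ) ∪ (S i.succ \ S i.castSucc)).card = 1) :
    (∀ i, IsCDS (hubGraph G k k' c) (liftSet k k' (S i)) ∧
        (liftSet k k' (S i)).card ≤ k + k') ∧
      ∀ i : Fin t,
        ((liftSet k k' (S i.castSucc) \ liftSet k k' (S i.succ)) ∪
          (liftSet k k' (S i.succ) \ liftSet k k' (S i.castSucc))).card = 1 := by
  refine ⟨fun i => ⟨⟨liftSet_dominates (S i), connected_induce_liftSet (hconn i) (hcolor i)⟩,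
    (card_liftSet_le (S i)).trans (Nat.add_le_add_right (hcard i) k')⟩, fun i => ?_⟩
  rw [card_symmDiff_liftSet, hstep i]
end
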